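/- arXiv:2502.08730 — 5 statements merged into one kernel-verified Lean document; each statement's English description precedes it below -/
import Mathlib

section
/- Let C be an N×N real positive definite matrix, m ∈ ℝ^N, y ∈ ℝ^N, and σ² > 0. Then the Gaussian expectation of the Gaussian log-likelihood satisfies ∫_{ℝ^N} N(f|m, C) · log N(y|f, σ²I) df = log N(y|m, σ²I) − (1/(2σ²)) tr(C). (This is the expected log-likelihood identity used in deriving the collapsed sparse variational GP bound, where C = K_ff − Q_ff gives the trace regularization term.) -/
open Matrix MeasureTheory

/-- Multivariate Gaussian density on ℝ^n with mean `μ` and covariance `S`. -/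
noncomputable def gaussPDF {n : ℕ} (μ : Fin n → ℝ) (S : Matrix (Fin n) (Fin n) ℝ)
    (x : Fin n → ℝ) : ℝ :=
  (Real.sqrt ((2 * Real.pi) ^ n * S.det))⁻¹ *
    Real.exp (-(1 / 2) * ((x - μ) ⬝ᵥ S⁻¹ *ᵥ (x - μ)))

open ProbabilityTheory in
theorem pi_gaussianReal_eq_withDensity {ι : Type*} [Fintype ι] (μ : ι → ℝ) (v : ι → NNReal)
    (hv : ∀ i, v i ≠ 0) :
    Measure.pi (fun i => gaussianReal (μ i) (v i)) =
      (volume : Measure (ι → ℝ)).withDensity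
        (fun x => ENNReal.ofReal (∏ i, gaussianPDFReal (μ i) (v i) (x i))) := by
  refine Measure.pi_eq fun s hs => ?_
  have hint : ∀ i, Integrable (gaussianPDFReal (μ i) (v i)) (volume.restrict (s i)) :=
    fun i => (integrable_gaussianPDFReal (μ i) (v i)).restrict
  rw [withDensity_apply _ (MeasurableSet.univ_pi hs), volume_pi, Measure.restrict_pi_pi,
    ← ofReal_integral_eq_lintegral_ofReal (Integrable.fintype_prod hint)
      (Filter.Eventually.of_forall fun x =>
        Finset.prod_nonneg fun i _ => gaussianPDFReal_nonneg _ _ _),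
    integral_fintype_prod_eq_prod, ENNReal.ofReal_prod_of_nonneg fun i _ =>
      integral_nonneg fun x => gaussianPDFReal_nonneg _ _ _]
  exact Finset.prod_congr rfl fun i _ => (gaussianReal_apply_eq_integral _ (hv i) _).symm

theorem integral_comp_mulVec_add {ι : Type*} [Fintype ι] [DecidableEq ι]
    {E : Type*} [NormedAddCommGroup E] [NormedSpace ℝ E]
    (A : Matrix ι ι ℝ) (hA : A.det ≠ 0) (m : ι → ℝ) (F : (ι → ℝ) → E) :
    ∫ f, F f = |A.det| • ∫ u, F (A *ᵥ u + m) := by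
  have hemb : MeasurableEmbedding (toLin' A) :=
    (LinearEquiv.toContinuousLinearEquiv
      (LinearEquiv.ofIsUnitDet (f := toLin' A) (v := Pi.basisFun ℝ ι) (v' := Pi.basisFun ℝ ι)
        (by simpa [LinearMap.toMatrix_eq_toMatrix'] using
          hA))).toHomeomorph.measurableEmbedding
  have h := hemb.integral_map (μ := volume) (fun x => F (x + m))
  rw [Real.map_matrix_volume_pi_eq_smul_volume_pi hA, integral_smul_measure,
    ENNReal.toReal_ofReal (abs_nonneg _), integral_add_right_eq_self (fun x => F x) m] at h
  simp only [toLin'_apply] at h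
  rw [← h, smul_smul, ← abs_mul, mul_inv_cancel₀ hA, abs_one, one_smul]

theorem gaussPDF_mulVec_add {N : ℕ} (A : Matrix (Fin N) (Fin N) ℝ) (hA : A.det ≠ 0)
    (m u : Fin N → ℝ) :
    |A.det| * gaussPDF m (A * Aᵀ) (A *ᵥ u + m) =
      ∏ i, ProbabilityTheory.gaussianPDFReal 0 1 (u i) := by
  have hAu : IsUnit A.det := hA.isUnit
  have hq : (A *ᵥ u) ⬝ᵥ (A * Aᵀ)⁻¹ *ᵥ (A *ᵥ u) = u ⬝ᵥ u := by
    rw [Matrix.mul_inv_rev, ← Matrix.mulVec_mulVec, Matrix.mulVec_mulVec _ A⁻¹ A,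
      Matrix.nonsing_inv_mul _ hAu, Matrix.one_mulVec, ← Matrix.transpose_nonsing_inv,
      Matrix.mulVec_transpose, dotProduct_comm, ← Matrix.dotProduct_mulVec, Matrix.mulVec_mulVec,
      Matrix.nonsing_inv_mul _ hAu, Matrix.one_mulVec]
  have hd : Real.sqrt ((2 * Real.pi) ^ N * (A * Aᵀ).det) =
      Real.sqrt (2 * Real.pi) ^ N * |A.det| := by
    have hp : (2 * Real.pi) ^ N = (Real.sqrt (2 * Real.pi) ^ N) ^ 2 := by
      rw [pow_right_comm, Real.sq_sqrt (by positivity)]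
    rw [Matrix.det_mul, Matrix.det_transpose, Real.sqrt_mul (by positivity),
      Real.sqrt_mul_self_eq_abs, hp, Real.sqrt_sq (by positivity)]
  simp only [gaussPDF, ProbabilityTheory.gaussianPDFReal, add_sub_cancel_right, hq, hd,
    Finset.prod_mul_distrib, ← Real.exp_sum, Finset.prod_const, Finset.card_univ, Fintype.card_fin]
  have h0 : |A.det| ≠ 0 := abs_ne_zero.mpr hA
  rw [← mul_assoc, mul_inv, mul_comm _ (|A.det|)⁻¹, mul_inv_cancel_left₀ h0]
  congr 1
  · rw [NNReal.coe_one, mul_one, inv_pow]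
  · congr 1
    simp only [dotProduct, Finset.mul_sum]
    refine Finset.sum_congr rfl fun i _ => ?_
    simp
    ring

open ProbabilityTheory in
theorem integral_gaussPDF_mul {N : ℕ} (A : Matrix (Fin N) (Fin N) ℝ) (hA : A.det ≠ 0)
    (m : Fin N → ℝ) (g : (Fin N → ℝ) → ℝ) :
    ∫ f, gaussPDF m (A * Aᵀ) f * g f =
      ∫ u, g (A *ᵥ u + m) ∂(Measure.pi fun _ : Fin N => gaussianReal 0 1) := by
  rw [integral_comp_mulVec_add A hA m, pi_gaussianReal_eq_withDensity _ _ (by simp),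
    integral_withDensity_eq_integral_toReal_smul (by fun_prop) (by simp), ← integral_smul]
  refine integral_congr_ae (Filter.Eventually.of_forall fun u => ?_)
  simp only [smul_eq_mul]
  rw [← mul_assoc, gaussPDF_mulVec_add A hA, ENNReal.toReal_ofReal
    (Finset.prod_nonneg fun i _ => gaussianPDFReal_nonneg _ _ _)]

open ProbabilityTheory in
theorem memLp_two_dotProduct_gaussianReal {ι : Type*} [Fintype ι] (a : ι → ℝ) :
    MemLp (fun u => a ⬝ᵥ u) 2 (Measure.pi fun _ : ι => gaussianReal 0 1) :=
  memLp_finsetSum _ fun i _ => ((memLp_id_gaussianReal' 2 (by simp)).comp_measurePreserving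
    (measurePreserving_eval _ i)).const_mul (a i)

open ProbabilityTheory in
theorem integral_dotProduct_gaussianReal {ι : Type*} [Fintype ι] (a : ι → ℝ) :
    ∫ u, a ⬝ᵥ u ∂(Measure.pi fun _ : ι => gaussianReal 0 1) = 0 := by
  have hid : Integrable (fun x : ℝ => x) (gaussianReal 0 1) :=
    (memLp_id_gaussianReal' 1 (by simp)).integrable le_rfl
  simp only [dotProduct]
  rw [integral_finsetSum _ fun i _ =>
    (integrable_comp_eval (μ := fun _ : ι => gaussianReal 0 1) (i := i) hid).const_mul (a i)]
  refine Finset.sum_eq_zero fun i _ => ?_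
  rw [integral_const_mul,
    integral_comp_eval (μ := fun _ : ι => gaussianReal 0 1) (i := i) hid.aestronglyMeasurable,
    integral_id_gaussianReal, mul_zero]

open ProbabilityTheory in
theorem variance_dotProduct_gaussianReal {ι : Type*} [Fintype ι] (a : ι → ℝ) :
    Var[fun u => a ⬝ᵥ u; Measure.pi fun _ : ι => gaussianReal 0 1] = a ⬝ᵥ a := by
  have h := variance_sum_pi (μ := fun _ : ι => gaussianReal 0 1) (X := fun i x => a i * id x)
    fun i => (memLp_id_gaussianReal' 2 (by simp)).const_mul (a i)
  simp only [variance_const_mul, variance_id_gaussianReal] at h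
  convert h using 1
  · congr 1
    ext u
    simp [dotProduct]
  · simp [dotProduct, sq]

open ProbabilityTheory in
theorem integral_const_sub_dotProduct_sq_gaussianReal {ι : Type*} [Fintype ι] (d : ℝ)
    (a : ι → ℝ) :
    ∫ u, (d - a ⬝ᵥ u) ^ 2 ∂(Measure.pi fun _ : ι => gaussianReal 0 1) = d ^ 2 + a ⬝ᵥ a := by
  have hX := memLp_two_dotProduct_gaussianReal a
  have h := variance_eq_sub ((memLp_const d).sub hX)
  have hv := variance_const_sub hX.aestronglyMeasurable d
  rw [variance_dotProduct_gaussianReal] at hv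
  have he : ∫ u, (d - a ⬝ᵥ u) ∂(Measure.pi fun _ : ι => gaussianReal 0 1) = d := by
    rw [integral_sub (integrable_const d) (hX.integrable (by simp)),
      integral_dotProduct_gaussianReal]
    simp
  have h' : a ⬝ᵥ a = (∫ u, (d - a ⬝ᵥ u) ^ 2 ∂(Measure.pi fun _ : ι => gaussianReal 0 1)) -
      (∫ u, (d - a ⬝ᵥ u) ∂(Measure.pi fun _ : ι => gaussianReal 0 1)) ^ 2 := hv.symm.trans h
  rw [he] at h'
  linarith

theorem log_gaussPDF_smul_one {N : ℕ} (f y : Fin N → ℝ) {σ2 : ℝ} (hσ2 : 0 < σ2) :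
    Real.log (gaussPDF f (σ2 • (1 : Matrix (Fin N) (Fin N) ℝ)) y) =
      Real.log (Real.sqrt ((2 * Real.pi) ^ N * σ2 ^ N))⁻¹ -
        (1 / (2 * σ2)) * ∑ i, (y i - f i) ^ 2 := by
  have hinv : (σ2 • (1 : Matrix (Fin N) (Fin N) ℝ))⁻¹ = σ2⁻¹ • 1 :=
    Matrix.inv_eq_right_inv (by simp [smul_smul, hσ2.ne'])
  have hdet : (σ2 • (1 : Matrix (Fin N) (Fin N) ℝ)).det = σ2 ^ N := by simp
  rw [gaussPDF, hdet, hinv, Real.log_mul (by positivity) (Real.exp_ne_zero _), Real.log_exp,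
    Matrix.smul_mulVec, Matrix.one_mulVec, dotProduct_smul]
  have : (y - f) ⬝ᵥ (y - f) = ∑ i, (y i - f i) ^ 2 := by simp [dotProduct, sq]
  rw [this, smul_eq_mul]
  field_simp
  ring

open scoped MatrixOrder in
theorem exists_mul_transpose_of_posDef {N : ℕ} {C : Matrix (Fin N) (Fin N) ℝ} (hC : C.PosDef) :
    ∃ A : Matrix (Fin N) (Fin N) ℝ, A.det ≠ 0 ∧ C = A * Aᵀ := by
  obtain ⟨B, hB⟩ := CStarAlgebra.nonneg_iff_eq_star_mul_self.mp hC.posSemidef.nonneg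
  have hB' : C = Bᵀ * Bᵀᵀ := by
    rw [hB, Matrix.star_eq_conjTranspose, Matrix.conjTranspose_eq_transpose_of_trivial,
      Matrix.transpose_transpose]
  refine ⟨Bᵀ, fun h => hC.det_pos.ne' ?_, hB'⟩
  rw [hB', Matrix.det_mul, h, zero_mul]

theorem stmt_3 {N : ℕ} (C : Matrix (Fin N) (Fin N) ℝ) (hC : C.PosDef)
    (m y : Fin N → ℝ) (σ2 : ℝ) (hσ2 : 0 < σ2) :
    (∫ f : Fin N → ℝ,
        gaussPDF m C f * Real.log (gaussPDF f (σ2 • (1 : Matrix (Fin N) (Fin N) ℝ)) y)) =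
      Real.log (gaussPDF m (σ2 • (1 : Matrix (Fin N) (Fin N) ℝ)) y) -
        (1 / (2 * σ2)) * C.trace := by
  obtain ⟨A, hA, rfl⟩ := exists_mul_transpose_of_posDef hC
  have hsub : ∀ (u : Fin N → ℝ) i, y i - (A *ᵥ u + m) i = (y i - m i) - A i ⬝ᵥ u := by
    intro u i
    simp only [Pi.add_apply, Matrix.mulVec]
    ring
  have hint : ∀ i, Integrable (fun u => ((y i - m i) - A i ⬝ᵥ u) ^ 2)
      (Measure.pi fun _ : Fin N => ProbabilityTheory.gaussianReal 0 1) := fun i =>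
    ((memLp_const _).sub (memLp_two_dotProduct_gaussianReal (A i))).integrable_sq
  rw [integral_gaussPDF_mul A hA]
  simp only [log_gaussPDF_smul_one _ _ hσ2, hsub]
  rw [integral_sub (integrable_const _) ((integrable_finsetSum _ fun i _ => hint i).const_mul _),
    integral_const_mul, integral_finsetSum _ fun i _ => hint i]
  simp only [integral_const_sub_dotProduct_sq_gaussianReal, Finset.sum_add_distrib,
    integral_const, probReal_univ, one_smul]
  have htr : (A * Aᵀ).trace = ∑ i, A i ⬝ᵥ A i := rfl
  rw [htr]
  ring
end

section
/- (The new collapsed bound lower-bounds the exact log marginal likelihood.) Let K_uu be an M×M real positive definite matrix, K_fu an N×M real matrix, and K_ff an N×N real symmetric matrix such that the block matrix [[K_ff, K_fu],[K_fuᵀ, K_uu]] is positive semidefinite. Set Q_ff = K_fu K_uu⁻¹ K_fuᵀ and K̃ = K_ff − Q_ff. Then for every y ∈ ℝ^N and σ² > 0, log N(y|0, Q_ff + σ²I) − (1/2) Σ_{i=1}^N log(1 + K̃_{ii}/σ²) ≤ log N(y|0, K_ff + σ²I), where log N(y|0, Σ) = −(N/2) log(2π) − (1/2) log det Σ − (1/2)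 yᵀ Σ⁻¹ y. -/
open Matrix

/-- Log-density of the multivariate Gaussian with mean 0 and covariance `S` on ℝ^n:
`log N(y|0,S) = -(n/2) log(2π) - (1/2) log det S - (1/2) yᵀ S⁻¹ y`. -/
noncomputable def logGaussPDF0 {n : ℕ} (S : Matrix (Fin n) (Fin n) ℝ) (y : Fin n → ℝ) : ℝ :=
  -((n : ℝ) / 2) * Real.log (2 * Real.pi) - (1 / 2) * Real.log S.det -
    (1 / 2) * (y ⬝ᵥ S⁻¹ *ᵥ y)

namespace Matrix

variable {n : Type*} [Fintype n]

lemma PosSemidef.exists_eq_transpose_mul_self {K : Matrix n n ℝ}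
    (hK : K.PosSemidef) : ∃ B : Matrix n n ℝ, K = Bᵀ * B := by
  classical
  open scoped MatrixOrder Matrix.Norms.L2Operator in
  obtain ⟨B, hB⟩ := CStarAlgebra.nonneg_iff_eq_star_mul_self.mp hK.nonneg
  exact ⟨B, by simpa [star_eq_conjTranspose] using hB⟩

variable [DecidableEq n]

lemma PosDef.det_le_exp_trace_sub_card {Z : Matrix n n ℝ} (hZ : Z.PosDef) :
    Z.det ≤ Real.exp (Z.trace - Fintype.card n) := by
  have hdet : Z.det = ∏ i, hZ.1.eigenvalues i := by
    simpa using hZ.1.det_eq_prod_eigenvalues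
  have htrace : Z.trace = ∑ i, hZ.1.eigenvalues i := by
    simpa using hZ.1.trace_eq_sum_eigenvalues
  have hsum : Z.trace - Fintype.card n = ∑ i, (hZ.1.eigenvalues i - 1) := by
    simp [htrace]
  rw [hdet, hsum, Real.exp_sum]
  refine Finset.prod_le_prod (fun i _ => (hZ.eigenvalues_pos i).le) fun i _ => ?_
  linarith [Real.add_one_le_exp (hZ.1.eigenvalues i - 1)]

/-- **Hadamard's inequality** for positive definite matrices. -/
lemma PosDef.det_le_prod_diag {S : Matrix n n ℝ} (hS : S.PosDef) :
    S.det ≤ ∏ i, S i i := by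
  have hpos (i : n) : 0 < S i i := hS.diag_pos
  set d : n → ℝ := fun i => (√(S i i))⁻¹ with hd
  have hdpos (i : n) : 0 < d i := inv_pos.mpr (Real.sqrt_pos.mpr (hpos i))
  have hdd (i : n) : d i * d i = (S i i)⁻¹ := by
    rw [hd, ← mul_inv, Real.mul_self_sqrt (hpos i).le]
  have hinj : Function.Injective (diagonal d).mulVec := by
    apply mulVec_injective_of_isUnit
    rw [isUnit_iff_isUnit_det, det_diagonal, isUnit_iff_ne_zero]
    exact (Finset.prod_pos fun i _ => hdpos i).ne'
  have hZ : (diagonal d * S * diagonal d).PosDef := by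
    simpa using hS.conjTranspose_mul_mul_same hinj
  have htrace : (diagonal d * S * diagonal d).trace = Fintype.card n := by
    have (i : n) : d i * S i i * d i = 1 := by
      rw [mul_right_comm, hdd, inv_mul_cancel₀ (hpos i).ne']
    simp [trace, mul_diagonal, diagonal_mul, this]
  have h := hZ.det_le_exp_trace_sub_card
  rw [htrace, sub_self, Real.exp_zero, det_mul, det_mul, det_diagonal, mul_right_comm,
    ← Finset.prod_mul_distrib, Finset.prod_congr rfl fun i _ => hdd i, Finset.prod_inv_distrib,
    inv_mul_le_one₀ (Finset.prod_pos fun i _ => hpos i)] at h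
  exact h

/-- Inversion is antitone on positive definite matrices, in terms of quadratic forms. -/
lemma PosDef.dotProduct_inv_add_mulVec_le {A K : Matrix n n ℝ} (hA : A.PosDef)
    (hK : K.PosSemidef) (y : n → ℝ) :
    y ⬝ᵥ (A + K)⁻¹ *ᵥ y ≤ y ⬝ᵥ A⁻¹ *ᵥ y := by
  have hdetA : IsUnit A.det := (isUnit_iff_isUnit_det A).mp hA.isUnit
  have hdetB : IsUnit (A + K).det :=
    (isUnit_iff_isUnit_det _).mp (hA.add_posSemidef hK).isUnit
  set u := A⁻¹ *ᵥ y
  set v := (A + K)⁻¹ *ᵥ y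
  have hu : A *ᵥ u = y := by simp [u, mulVec_mulVec, mul_nonsing_inv _ hdetA]
  have hv : A *ᵥ v + K *ᵥ v = y := by
    rw [← add_mulVec]; simp [v, mulVec_mulVec, mul_nonsing_inv _ hdetB]
  have h1 := hA.posSemidef.dotProduct_mulVec_nonneg (u - v)
  have h2 := hK.dotProduct_mulVec_nonneg v
  have hsymm : u ⬝ᵥ A *ᵥ v = v ⬝ᵥ A *ᵥ u := by
    have hT : Aᵀ = A := by simpa using hA.1.eq
    rw [dotProduct_mulVec, ← mulVec_transpose, hT, dotProduct_comm]
  have h3 : v ⬝ᵥ A *ᵥ v + v ⬝ᵥ K *ᵥ v = v ⬝ᵥ y := by rw [← dotProduct_add, hv]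
  simp only [star_trivial, mulVec_sub, dotProduct_sub, sub_dotProduct, hsymm, hu] at h1 h2
  rw [dotProduct_comm y v, dotProduct_comm y u]
  linarith

lemma PosSemidef.one_le_det_one_add {P : Matrix n n ℝ} (hP : P.PosSemidef) :
    1 ≤ (1 + P).det := by
  have hW : (1 + P).PosDef := PosDef.one.add_posSemidef hP
  have htrace : (1 + P)⁻¹.trace ≤ Fintype.card n := by
    calc (1 + P)⁻¹.trace ≤ ∑ _i : n, (1 : ℝ) := Finset.sum_le_sum fun i _ => by
          simpa using PosDef.one.dotProduct_inv_add_mulVec_le hP (Pi.single i 1)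
      _ = Fintype.card n := by simp
  have h := hW.inv.det_le_exp_trace_sub_card.trans
    (Real.exp_le_one_iff.mpr (sub_nonpos.mpr htrace))
  rw [det_nonsing_inv, Ring.inverse_eq_inv'] at h
  exact (inv_le_one₀ hW.det_pos).mp h

lemma PosDef.det_add_transpose_mul_self {A : Matrix n n ℝ} (hA : A.PosDef)
    (B : Matrix n n ℝ) : (A + Bᵀ * B).det = A.det * (1 + B * A⁻¹ * Bᵀ).det := by
  have hdet : IsUnit A.det := (isUnit_iff_isUnit_det A).mp hA.isUnit
  rw [Matrix.mul_assoc, det_one_add_mul_comm, ← det_mul, mul_add, mul_one, Matrix.mul_assoc,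
    mul_nonsing_inv_cancel_left _ _ hdet]

lemma PosDef.det_le_det_add {A K : Matrix n n ℝ} (hA : A.PosDef) (hK : K.PosSemidef) :
    A.det ≤ (A + K).det := by
  obtain ⟨B, rfl⟩ := hK.exists_eq_transpose_mul_self
  rw [hA.det_add_transpose_mul_self]
  refine le_mul_of_one_le_right hA.det_pos.le (PosSemidef.one_le_det_one_add ?_)
  simpa using hA.inv.posSemidef.mul_mul_conjTranspose_same B

lemma det_add_smul_one_add_le {Q K : Matrix n n ℝ} (hQ : Q.PosSemidef) (hK : K.PosSemidef)
    {s : ℝ} (hs : 0 < s) :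
    (Q + s • 1 + K).det ≤ (Q + s • 1).det * ∏ i, (1 + K i i / s) := by
  have hs1 : (s • (1 : Matrix n n ℝ)).PosDef := PosDef.one.smul hs
  have hA : (Q + s • 1).PosDef := hs1.posSemidef_add hQ
  obtain ⟨B, hB⟩ := hK.exists_eq_transpose_mul_self
  have hKs : (1 + s⁻¹ • K).PosDef :=
    PosDef.one.add_posSemidef (hK.smul (inv_pos.mpr hs).le)
  have hinv : (s • (1 : Matrix n n ℝ))⁻¹ = s⁻¹ • 1 := by
    apply inv_eq_left_inv
    simp [smul_smul, mul_inv_cancel₀ hs.ne']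
  have hdiff : (s⁻¹ • (1 : Matrix n n ℝ) - (Q + s • 1)⁻¹).PosSemidef := by
    refine PosSemidef.of_dotProduct_mulVec_nonneg
      (hinv ▸ hs1.inv.1.sub hA.inv.1) fun x => ?_
    have := hs1.dotProduct_inv_add_mulVec_le hQ x
    rw [hinv, add_comm] at this
    simpa only [star_trivial, sub_mulVec, dotProduct_sub, sub_nonneg] using this
  have hX : (1 + B * (Q + s • 1)⁻¹ * Bᵀ).PosDef := by
    refine PosDef.one.add_posSemidef ?_
    simpa using hA.inv.posSemidef.mul_mul_conjTranspose_same B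
  have hle : (1 + B * (Q + s • 1)⁻¹ * Bᵀ).det ≤ (1 + s⁻¹ • K).det := by
    have h := hX.det_le_det_add (hdiff.mul_mul_conjTranspose_same B)
    have heq : 1 + B * (Q + s • 1)⁻¹ * Bᵀ + B * (s⁻¹ • 1 - (Q + s • 1)⁻¹) * Bᴴ =
        1 + B * (s⁻¹ • Bᵀ) := by
      simp [mul_sub, sub_mul, add_assoc]
    rwa [heq, det_one_add_mul_comm B, smul_mul, ← hB] at h
  have hhad : (1 + s⁻¹ • K).det ≤ ∏ i, (1 + K i i / s) := by
    simpa [div_eq_inv_mul] using hKs.det_le_prod_diag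
  calc (Q + s • 1 + K).det = (Q + s • 1).det * (1 + B * (Q + s • 1)⁻¹ * Bᵀ).det := by
        rw [hB, hA.det_add_transpose_mul_self]
    _ ≤ _ := mul_le_mul_of_nonneg_left (hle.trans hhad) hA.det_pos.le

end Matrix

theorem stmt_6 {N M : ℕ}
    (Kuu : Matrix (Fin M) (Fin M) ℝ) (hKuu : Kuu.PosDef)
    (Kfu : Matrix (Fin N) (Fin M) ℝ)
    (Kff : Matrix (Fin N) (Fin N) ℝ) (hKff : Kff.IsSymm)
    (hblock : (Matrix.fromBlocks Kff Kfu Kfuᵀ Kuu).PosSemidef)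
    (y : Fin N → ℝ) (σ2 : ℝ) (hσ2 : 0 < σ2) :
    logGaussPDF0 (Kfu * Kuu⁻¹ * Kfuᵀ + σ2 • (1 : Matrix (Fin N) (Fin N) ℝ)) y -
        (1 / 2) * ∑ i, Real.log (1 + (Kff - Kfu * Kuu⁻¹ * Kfuᵀ) i i / σ2) ≤
      logGaussPDF0 (Kff + σ2 • (1 : Matrix (Fin N) (Fin N) ℝ)) y := by
  have : Invertible Kuu := hKuu.isUnit.invertible
  have hK : (Kff - Kfu * Kuu⁻¹ * Kfuᵀ).PosSemidef := by
    simpa using (PosDef.fromBlocks₂₂ Kff Kfu hKuu).mp (by simpa using hblock)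
  have hQ : (Kfu * Kuu⁻¹ * Kfuᵀ).PosSemidef := by
    simpa using hKuu.inv.posSemidef.mul_mul_conjTranspose_same Kfu
  set Q := Kfu * Kuu⁻¹ * Kfuᵀ
  set K := Kff - Q with hKdef
  have hsum : Kff + σ2 • (1 : Matrix (Fin N) (Fin N) ℝ) = Q + σ2 • 1 + K := by
    rw [hKdef]; abel
  have hA : (Q + σ2 • (1 : Matrix (Fin N) (Fin N) ℝ)).PosDef :=
    (PosDef.one.smul hσ2).posSemidef_add hQ
  have hfac (i : Fin N) : 0 < 1 + K i i / σ2 :=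
    add_pos_of_pos_of_nonneg one_pos (div_nonneg hK.diag_nonneg hσ2.le)
  have hquad := hA.dotProduct_inv_add_mulVec_le hK y
  have hlog := Real.log_le_log (hA.add_posSemidef hK).det_pos (det_add_smul_one_add_le hQ hK hσ2)
  rw [Real.log_mul hA.det_pos.ne' (Finset.prod_pos fun i _ => hfac i).ne',
    Real.log_prod fun i _ => (hfac i).ne'] at hlog
  rw [hsum]
  unfold logGaussPDF0
  linarith
end

section
/- (Artemev–Burt's collapsed bound lower-bounds the exact log marginal likelihood.) Let K_uu be an M×M real positive definite matrix, K_fu an N×M real matrix, and K_ff an N×N real symmetric matrix such that the block matrix [[K_ff, K_fu],[K_fuᵀ, K_uu]] is positive semidefinite. Set Q_ff = K_fu K_uu⁻¹ K_fuᵀ and K̃ = K_ff − Q_ff. Then for every y ∈ ℝ^N and σ² > 0, log N(y|0, Q_ff + σ²I) − (N/2) log(1 + tr(K̃)/(N σ²)) ≤ log N(y|0, K_ff + σ²I). -/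
open Matrix

namespace Matrix

variable {n : Type*} [Fintype n] [DecidableEq n]

/-- Inversion is antitone in the Loewner order. -/
theorem PosDef.posSemidef_inv_sub_inv {A B : Matrix n n ℝ} (hA : A.PosDef)
    (hAB : (B - A).PosSemidef) : (A⁻¹ - B⁻¹).PosSemidef := by
  have hB : B.PosDef := by simpa using hA.add_posSemidef hAB
  let := hB.isUnit.invertible
  let := hA.inv.isUnit.invertible
  have h₁ := hB.fromBlocks₁₁ 1 A⁻¹
  have h₂ := hA.inv.fromBlocks₂₂ B 1
  rw [conjTranspose_one] at h₁ h₂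
  have hdet : IsUnit A.det := (isUnit_iff_isUnit_det A).1 hA.isUnit
  simp only [one_mul, mul_one, nonsing_inv_nonsing_inv A hdet] at h₁ h₂
  exact h₁.1 (h₂.2 hAB)

/-- The AM-GM inequality for the eigenvalues of a positive semidefinite matrix. -/
theorem PosSemidef.det_le_trace_div_card_pow {S : Matrix n n ℝ} (hS : S.PosSemidef) :
    S.det ≤ (S.trace / Fintype.card n) ^ Fintype.card n := by
  rcases isEmpty_or_nonempty n with hn | hn
  · simp
  have hc : (0 : ℝ) < Fintype.card n := by exact_mod_cast Fintype.card_pos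
  have hpos := fun i (_ : i ∈ Finset.univ) => hS.eigenvalues_nonneg i
  have h := Real.geom_mean_le_arith_mean Finset.univ (fun _ => 1) hS.1.eigenvalues
    (fun _ _ => zero_le_one) (by simpa using hc) hpos
  have hdet := hS.1.det_eq_prod_eigenvalues
  have htr := hS.1.trace_eq_sum_eigenvalues
  simp only [RCLike.ofReal_real_eq_id, id] at hdet htr
  simp only [Real.rpow_one, one_mul, Finset.sum_const, Finset.card_univ, nsmul_eq_mul, mul_one,
    ← hdet, ← htr] at h
  have h' := pow_le_pow_left₀ (Real.rpow_nonneg hS.det_nonneg _) h (Fintype.card n)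
  rwa [Real.rpow_inv_natCast_pow hS.det_nonneg Fintype.card_ne_zero] at h'

/-- If `A ≥ c • 1` with `c > 0` and `E` is positive semidefinite, then `det (A + E)` exceeds `det A`
by at most the factor `(1 + tr E / (n c)) ^ n`. -/
theorem PosDef.det_add_le {A E : Matrix n n ℝ} {c : ℝ} (hc : 0 < c)
    (hA : (A - c • (1 : Matrix n n ℝ)).PosSemidef) (hE : E.PosSemidef) :
    (A + E).det ≤ A.det * (1 + E.trace / (Fintype.card n * c)) ^ Fintype.card n := by
  have hc1 : (c • (1 : Matrix n n ℝ)).PosDef := PosDef.one.smul hc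
  have hApd : A.PosDef := by simpa using hc1.add_posSemidef hA
  have hdet : IsUnit A.det := (isUnit_iff_isUnit_det A).1 hApd.isUnit
  obtain ⟨C, rfl⟩ : ∃ C : Matrix n n ℝ, E = Cᴴ * C := by
    open scoped MatrixOrder in
    exact CStarAlgebra.nonneg_iff_eq_star_mul_self.1 hE.nonneg
  have hP : (C * A⁻¹ * Cᴴ).PosSemidef := hApd.inv.posSemidef.mul_mul_conjTranspose_same C
  have hfactor : (A + Cᴴ * C).det = A.det * (1 + C * A⁻¹ * Cᴴ).det := by
    rw [mul_assoc, det_one_add_mul_comm, ← det_mul, mul_add, mul_one, ← mul_assoc, ← mul_assoc,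
      mul_nonsing_inv A hdet, one_mul]
  have htrace : (C * A⁻¹ * Cᴴ).trace ≤ (Cᴴ * C).trace / c := by
    have h := ((hc1.posSemidef_inv_sub_inv hA).mul_mul_conjTranspose_same C).trace_nonneg
    have hinv : (c • (1 : Matrix n n ℝ))⁻¹ = c⁻¹ • 1 :=
      inv_eq_right_inv (by simp [smul_smul, hc.ne'])
    rw [hinv, mul_sub, sub_mul, trace_sub, Matrix.mul_smul, mul_one, Matrix.smul_mul, trace_smul,
      trace_mul_comm C, smul_eq_mul] at h
    rw [div_eq_inv_mul]
    linarith
  rw [hfactor]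
  gcongr
  · exact hApd.det_pos.le
  refine (PosSemidef.one.add hP).det_le_trace_div_card_pow.trans ?_
  rcases isEmpty_or_nonempty n with hn | hn
  · simp
  have hcard : (0 : ℝ) < Fintype.card n := by exact_mod_cast Fintype.card_pos
  have hnonneg : 0 ≤ (1 + C * A⁻¹ * Cᴴ).trace := (PosSemidef.one.add hP).trace_nonneg
  gcongr
  rw [trace_add, trace_one, add_div, div_self hcard.ne', mul_comm, ← div_div]
  gcongr

end Matrix

theorem stmt_9 {N M : ℕ}
    (Kuu : Matrix (Fin M) (Fin M) ℝ) (hKuu : Kuu.PosDef)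
    (Kfu : Matrix (Fin N) (Fin M) ℝ)
    (Kff : Matrix (Fin N) (Fin N) ℝ) (hKff : Kff.IsSymm)
    (hblock : (Matrix.fromBlocks Kff Kfu Kfuᵀ Kuu).PosSemidef)
    (y : Fin N → ℝ) (σ2 : ℝ) (hσ2 : 0 < σ2) :
    logGaussPDF0 (Kfu * Kuu⁻¹ * Kfuᵀ + σ2 • (1 : Matrix (Fin N) (Fin N) ℝ)) y -
        ((N : ℝ) / 2) * Real.log (1 + (Kff - Kfu * Kuu⁻¹ * Kfuᵀ).trace / ((N : ℝ) * σ2)) ≤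
      logGaussPDF0 (Kff + σ2 • (1 : Matrix (Fin N) (Fin N) ℝ)) y := by
  let := hKuu.isUnit.invertible
  rw [← conjTranspose_eq_transpose_of_trivial] at hblock ⊢
  have hE := (hKuu.fromBlocks₂₂ Kff Kfu).1 hblock
  have hQ : (Kfu * Kuu⁻¹ * Kfuᴴ).PosSemidef :=
    hKuu.inv.posSemidef.mul_mul_conjTranspose_same Kfu
  generalize Kfu * Kuu⁻¹ * Kfuᴴ = Q at hE hQ ⊢
  obtain ⟨E, rfl⟩ : ∃ E, Kff = Q + E := ⟨Kff - Q, by abel⟩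
  rw [add_sub_cancel_left] at hE ⊢
  have hA : (Q + σ2 • (1 : Matrix (Fin N) (Fin N) ℝ)).PosDef :=
    PosDef.posSemidef_add hQ (PosDef.one.smul hσ2)
  have hdet := PosDef.det_add_le (A := Q + σ2 • 1) hσ2 (by simpa using hQ) hE
  have hinv := (hA.posSemidef_inv_sub_inv (B := Q + σ2 • 1 + E)
    (by simpa using hE)).dotProduct_mulVec_nonneg y
  have hB : (Q + σ2 • 1 + E).PosDef := hA.add_posSemidef hE
  have ht : 0 < 1 + E.trace / (N * σ2) := by
    have := hE.trace_nonneg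
    positivity
  rw [Fintype.card_fin] at hdet
  have hlog := Real.log_le_log hB.det_pos hdet
  rw [Real.log_mul hA.det_pos.ne' (by positivity), Real.log_pow] at hlog
  rw [star_trivial, sub_mulVec, dotProduct_sub] at hinv
  rw [add_right_comm Q E]
  unfold logGaussPDF0
  linarith
end

section
/- (Form of the optimal variational distribution q*(u).) Let K_uu be an M×M real positive definite matrix, K_fu an N×M real matrix, y ∈ ℝ^N, σ² > 0. Set A = K_fu K_uu⁻¹, Q_ff = K_fu K_uu⁻¹ K_fuᵀ, and Λ = K_uu + σ⁻² K_fuᵀ K_fu (which is positive definite). Then for every u ∈ ℝ^M, N(y | Au, σ²I) · N(u | 0, K_uu) = N(y | 0, Q_ff + σ²I) · N(u | σ⁻² K_uu Λ⁻¹ K_fuᵀ y, K_uu Λ⁻¹ K_uu). In particular, the optimal q*(u) ∝ N(y | K_fu K_uu⁻¹ u, σ²I) p(u) is the Gaussian with mean σ⁻² K_uu Λ⁻¹ K_fuᵀ y and covariance K_uu Λ⁻¹ K_uu. -/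
open Matrix

/-- Products of Gaussian densities agree as soon as the products of the covariance determinants
and the sums of the quadratic forms do. -/
lemma gaussPDF_mul_eq_mul {n m : ℕ} {μ₁ μ₂ x : Fin n → ℝ} {ν₁ ν₂ z : Fin m → ℝ}
    {S₁ S₂ : Matrix (Fin n) (Fin n) ℝ} {T₁ T₂ : Matrix (Fin m) (Fin m) ℝ}
    (hS₁ : 0 ≤ S₁.det) (hS₂ : 0 ≤ S₂.det) (hdet : S₁.det * T₁.det = S₂.det * T₂.det)
    (hquad : (x - μ₁) ⬝ᵥ S₁⁻¹ *ᵥ (x - μ₁) + (z - ν₁) ⬝ᵥ T₁⁻¹ *ᵥ (z - ν₁) =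
      (x - μ₂) ⬝ᵥ S₂⁻¹ *ᵥ (x - μ₂) + (z - ν₂) ⬝ᵥ T₂⁻¹ *ᵥ (z - ν₂)) :
    gaussPDF μ₁ S₁ x * gaussPDF ν₁ T₁ z = gaussPDF μ₂ S₂ x * gaussPDF ν₂ T₂ z := by
  have hpi : (0 : ℝ) ≤ (2 * Real.pi) ^ n := by positivity
  unfold gaussPDF
  have hsqrt : √((2 * Real.pi) ^ n * S₁.det) * √((2 * Real.pi) ^ m * T₁.det) =
      √((2 * Real.pi) ^ n * S₂.det) * √((2 * Real.pi) ^ m * T₂.det) := by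
    rw [← Real.sqrt_mul (mul_nonneg hpi hS₁), ← Real.sqrt_mul (mul_nonneg hpi hS₂),
      mul_mul_mul_comm, hdet, mul_mul_mul_comm]
  rw [mul_mul_mul_comm, ← mul_inv, ← Real.exp_add, ← mul_add, hsqrt, hquad, mul_add,
    Real.exp_add, mul_inv, mul_mul_mul_comm]

lemma posDef_add_smul_transpose_mul_self {N M : ℕ} {K : Matrix (Fin M) (Fin M) ℝ}
    (hK : K.PosDef) (F : Matrix (Fin N) (Fin M) ℝ) {c : ℝ} (hc : 0 ≤ c) :
    (K + c • (Fᵀ * F)).PosDef := by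
  have h := (posSemidef_conjTranspose_mul_self F).smul hc
  rw [conjTranspose_eq_transpose_of_trivial] at h
  exact hK.add_posSemidef h

lemma posDef_mul_inv_mul_transpose_add_smul_one {N M : ℕ} {K : Matrix (Fin M) (Fin M) ℝ}
    (hK : K.PosDef) (F : Matrix (Fin N) (Fin M) ℝ) {s : ℝ} (hs : 0 < s) :
    (F * K⁻¹ * Fᵀ + s • (1 : Matrix (Fin N) (Fin N) ℝ)).PosDef := by
  have h := hK.inv.posSemidef.mul_mul_conjTranspose_same F
  rw [conjTranspose_eq_transpose_of_trivial] at h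
  exact PosDef.posSemidef_add h (PosDef.one.smul hs)

lemma det_smul_one_mul_det_add {N M : ℕ} {K : Matrix (Fin M) (Fin M) ℝ}
    (hK : IsUnit K.det) (F : Matrix (Fin N) (Fin M) ℝ) {s : ℝ} (hs : s ≠ 0) :
    (s • (1 : Matrix (Fin N) (Fin N) ℝ)).det * (K + s⁻¹ • (Fᵀ * F)).det =
      (F * K⁻¹ * Fᵀ + s • (1 : Matrix (Fin N) (Fin N) ℝ)).det * K.det := by
  have h₁ : F * K⁻¹ * Fᵀ + s • (1 : Matrix (Fin N) (Fin N) ℝ) =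
      s • (1 + F * K⁻¹ * (s⁻¹ • Fᵀ)) := by
    rw [smul_add, Matrix.mul_smul, smul_smul, mul_inv_cancel₀ hs, one_smul, add_comm]
  rw [h₁, ← Matrix.smul_mul, det_add_mul _ _ hK, det_smul, det_smul, det_one]
  ring

/-- The Woodbury identity for `F K⁻¹ Fᵀ + s I`. -/
lemma inv_mul_inv_mul_transpose_add_smul_one {N M : ℕ} {K : Matrix (Fin M) (Fin M) ℝ}
    (hK : IsUnit K) (F : Matrix (Fin N) (Fin M) ℝ) {s : ℝ} (hs : s ≠ 0)
    (hL : IsUnit (K + s⁻¹ • (Fᵀ * F))) :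
    (F * K⁻¹ * Fᵀ + s • (1 : Matrix (Fin N) (Fin N) ℝ))⁻¹ =
      s⁻¹ • (1 : Matrix (Fin N) (Fin N) ℝ) -
        (s⁻¹ * s⁻¹) • (F * (K + s⁻¹ • (Fᵀ * F))⁻¹ * Fᵀ) := by
  have hinv : (s • (1 : Matrix (Fin N) (Fin N) ℝ))⁻¹ = s⁻¹ • 1 :=
    inv_eq_right_inv (by simp [smul_smul, hs])
  have hunit : IsUnit (s • (1 : Matrix (Fin N) (Fin N) ℝ)) := by
    rw [isUnit_iff_isUnit_det, det_smul, det_one, mul_one]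
    exact (pow_ne_zero _ hs).isUnit
  have hK' : K⁻¹⁻¹ = K := nonsing_inv_nonsing_inv K ((isUnit_iff_isUnit_det K).mp hK)
  have h : K⁻¹⁻¹ + Fᵀ * (s • (1 : Matrix (Fin N) (Fin N) ℝ))⁻¹ * F = K + s⁻¹ • (Fᵀ * F) := by
    rw [hK', hinv]
    simp
  rw [add_comm, add_mul_mul_inv_eq_sub _ _ _ _ hunit (isUnit_nonsing_inv_iff.mpr hK)
    (by rwa [h]), h, hinv]
  simp [smul_smul]

/-- Completing the square in `w`. -/
lemma inv_smul_dotProduct_sub_add_dotProduct {N M : ℕ} {K : Matrix (Fin M) (Fin M) ℝ}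
    (F : Matrix (Fin N) (Fin M) ℝ) (y : Fin N → ℝ) (w v : Fin M → ℝ) (c : ℝ)
    (hsymm : (K + c • (Fᵀ * F)).IsSymm)
    (hv : (K + c • (Fᵀ * F)) *ᵥ v = c • Fᵀ *ᵥ y) :
    c * ((y - F *ᵥ w) ⬝ᵥ (y - F *ᵥ w)) + w ⬝ᵥ K *ᵥ w =
      c * (y ⬝ᵥ y) - c * (v ⬝ᵥ Fᵀ *ᵥ y) +
        (w - v) ⬝ᵥ (K + c • (Fᵀ * F)) *ᵥ (w - v) := by
  have hcross : v ⬝ᵥ (K + c • (Fᵀ * F)) *ᵥ w = c * (w ⬝ᵥ Fᵀ *ᵥ y) := by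
    rw [dotProduct_mulVec, ← mulVec_transpose, hsymm.eq, hv, dotProduct_comm, dotProduct_smul,
      smul_eq_mul]
  have hww : w ⬝ᵥ (K + c • (Fᵀ * F)) *ᵥ w = w ⬝ᵥ K *ᵥ w + c * (F *ᵥ w ⬝ᵥ F *ᵥ w) := by
    rw [add_mulVec, dotProduct_add, smul_mulVec, dotProduct_smul, smul_eq_mul,
      ← mulVec_mulVec, dotProduct_mulVec w Fᵀ, vecMul_transpose]
  have hyw : w ⬝ᵥ Fᵀ *ᵥ y = F *ᵥ w ⬝ᵥ y := by
    rw [dotProduct_mulVec, vecMul_transpose]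
  simp only [mulVec_sub, sub_dotProduct, dotProduct_sub, hcross, hww, hv, dotProduct_smul,
    smul_eq_mul, dotProduct_comm y (F *ᵥ w), hyw]
  ring

theorem stmt_11 {N M : ℕ}
    (Kuu : Matrix (Fin M) (Fin M) ℝ) (hKuu : Kuu.PosDef)
    (Kfu : Matrix (Fin N) (Fin M) ℝ)
    (y : Fin N → ℝ) (σ2 : ℝ) (hσ2 : 0 < σ2) :
    (Kuu + σ2⁻¹ • (Kfuᵀ * Kfu)).PosDef ∧
    ∀ u : Fin M → ℝ,
      gaussPDF ((Kfu * Kuu⁻¹) *ᵥ u) (σ2 • (1 : Matrix (Fin N) (Fin N) ℝ)) y *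
          gaussPDF 0 Kuu u =
        gaussPDF 0 (Kfu * Kuu⁻¹ * Kfuᵀ + σ2 • (1 : Matrix (Fin N) (Fin N) ℝ)) y *
          gaussPDF (σ2⁻¹ • ((Kuu * (Kuu + σ2⁻¹ • (Kfuᵀ * Kfu))⁻¹ * Kfuᵀ) *ᵥ y))
            (Kuu * (Kuu + σ2⁻¹ • (Kfuᵀ * Kfu))⁻¹ * Kuu) u := by
  have hΛ := posDef_add_smul_transpose_mul_self hKuu Kfu (inv_nonneg.mpr hσ2.le)
  have hs := hσ2.ne'
  refine ⟨hΛ, fun u => ?_⟩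
  have hQ := posDef_mul_inv_mul_transpose_add_smul_one hKuu Kfu hσ2
  have hdet := det_smul_one_mul_det_add hKuu.det_pos.ne'.isUnit Kfu hs
  have hwood := inv_mul_inv_mul_transpose_add_smul_one hKuu.isUnit Kfu hs hΛ.isUnit
  have hsquare := inv_smul_dotProduct_sub_add_dotProduct (K := Kuu) Kfu y (Kuu⁻¹ *ᵥ u)
    (σ2⁻¹ • (Kuu + σ2⁻¹ • (Kfuᵀ * Kfu))⁻¹ *ᵥ Kfuᵀ *ᵥ y) σ2⁻¹
    (by simpa using hΛ.isHermitian)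
    (by rw [mulVec_smul, mulVec_mulVec, mul_nonsing_inv _ hΛ.det_pos.ne'.isUnit, one_mulVec])
  set Λ := Kuu + σ2⁻¹ • (Kfuᵀ * Kfu)
  have hK := hKuu.det_pos.ne'.isUnit
  have hKsymm : Kuuᵀ = Kuu := by simpa using hKuu.isHermitian.eq
  have hinv : (σ2 • (1 : Matrix (Fin N) (Fin N) ℝ))⁻¹ = σ2⁻¹ • 1 :=
    inv_eq_right_inv (by simp [smul_smul, hs])
  have hu : Kuu *ᵥ Kuu⁻¹ *ᵥ u = u := by
    rw [mulVec_mulVec, mul_nonsing_inv _ hK, one_mulVec]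
  have hcov : (Kuu * Λ⁻¹ * Kuu)⁻¹ = Kuu⁻¹ * (Λ * Kuu⁻¹) := by
    rw [Matrix.mul_inv_rev, Matrix.mul_inv_rev, nonsing_inv_nonsing_inv _ hΛ.det_pos.ne'.isUnit]
  have hmean : u - σ2⁻¹ • ((Kuu * Λ⁻¹ * Kfuᵀ) *ᵥ y) =
      Kuu *ᵥ (Kuu⁻¹ *ᵥ u - σ2⁻¹ • Λ⁻¹ *ᵥ Kfuᵀ *ᵥ y) := by
    rw [mulVec_sub, hu, mulVec_smul, mulVec_mulVec, mulVec_mulVec, Matrix.mul_assoc]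
  have hcongr (w : Fin M → ℝ) :
      Kuu *ᵥ w ⬝ᵥ (Kuu⁻¹ * (Λ * Kuu⁻¹)) *ᵥ Kuu *ᵥ w = w ⬝ᵥ Λ *ᵥ w := by
    rw [mulVec_mulVec, Matrix.mul_assoc, Matrix.mul_assoc, nonsing_inv_mul _ hK, Matrix.mul_one,
      dotProduct_comm, dotProduct_mulVec, ← mulVec_transpose, hKsymm, mulVec_mulVec,
      ← Matrix.mul_assoc, mul_nonsing_inv _ hK, Matrix.one_mul, dotProduct_comm]
  refine gaussPDF_mul_eq_mul (PosDef.one.smul hσ2).det_pos.le hQ.det_pos.le ?_ ?_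
  · rw [det_mul, det_mul, det_nonsing_inv, Ring.inverse_eq_inv']
    have hΛ0 := hΛ.det_pos.ne'
    field_simp
    linear_combination Kuu.det * hdet
  · rw [hcov, hmean, hcongr, hwood, hinv, sub_zero, sub_zero, ← mulVec_mulVec, smul_mulVec,
      one_mulVec, dotProduct_smul, smul_eq_mul]
    have huu : u ⬝ᵥ Kuu⁻¹ *ᵥ u = Kuu⁻¹ *ᵥ u ⬝ᵥ Kuu *ᵥ Kuu⁻¹ *ᵥ u := by
      rw [hu, dotProduct_comm]
    have hyy : y ⬝ᵥ (Kfu * Λ⁻¹ * Kfuᵀ) *ᵥ y = Λ⁻¹ *ᵥ Kfuᵀ *ᵥ y ⬝ᵥ Kfuᵀ *ᵥ y := by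
      rw [← mulVec_mulVec, ← mulVec_mulVec, dotProduct_mulVec, ← mulVec_transpose,
        dotProduct_comm]
    rw [huu, hsquare, sub_mulVec, dotProduct_sub, smul_mulVec, smul_mulVec, one_mulVec,
      dotProduct_smul, dotProduct_smul, hyy, smul_dotProduct]
    simp only [smul_eq_mul]
    ring
end

section
/- (The standard collapsed SVGP bound lower-bounds the exact log marginal likelihood.) Let K_uu be an M×M real positive definite matrix, K_fu an N×M real matrix, and K_ff an N×N real symmetric matrix such that the block matrix [[K_ff, K_fu],[K_fuᵀ, K_uu]] is positive semidefinite. Set Q_ff = K_fu K_uu⁻¹ K_fuᵀ. Then for every y ∈ ℝ^N and σ² > 0, log N(y|0, Q_ff + σ²I) − (1/(2σ²)) tr(K_ff − Q_ff) ≤ log N(y|0, K_ff + σ²I). -/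
open Matrix

open scoped MatrixOrder in
theorem Matrix.PosSemidef.exists_eq_conjTranspose_mul_self {n : Type*} [Fintype n]
    {A : Matrix n n ℝ} (hA : A.PosSemidef) : ∃ C : Matrix n n ℝ, A = Cᴴ * C := by
  classical
  exact CStarAlgebra.nonneg_iff_eq_star_mul_self.mp hA.nonneg

/-- The inverse is antitone with respect to the Loewner order on positive definite matrices. -/
theorem Matrix.PosDef.posSemidef_inv_sub_inv_s17 {n : Type*} [Fintype n] [DecidableEq n]
    {A B : Matrix n n ℝ} (hA : A.PosDef) (hB : B.PosDef) (hAB : (B - A).PosSemidef) :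
    (A⁻¹ - B⁻¹).PosSemidef := by
  refine .of_dotProduct_mulVec_nonneg (hA.inv.isHermitian.sub hB.inv.isHermitian) fun y => ?_
  set u := B⁻¹ *ᵥ y with hu
  set v := A⁻¹ *ᵥ y with hv
  have hBu : B *ᵥ u = y := by
    rw [hu, mulVec_mulVec, mul_nonsing_inv _ ((isUnit_iff_isUnit_det B).1 hB.isUnit), one_mulVec]
  have hAv : A *ᵥ v = y := by
    rw [hv, mulVec_mulVec, mul_nonsing_inv _ ((isUnit_iff_isUnit_det A).1 hA.isUnit), one_mulVec]
  have h₁ := hAB.dotProduct_mulVec_nonneg u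
  have h₂ := hA.posSemidef.dotProduct_mulVec_nonneg (u - v)
  have hsymm : v ⬝ᵥ A *ᵥ u = y ⬝ᵥ u := by
    have hAt : Aᵀ = A := by simpa using hA.isHermitian.eq
    rw [dotProduct_mulVec, ← mulVec_transpose, hAt, hAv]
  simp only [star_trivial, sub_mulVec, mulVec_sub, sub_dotProduct, dotProduct_sub, hBu, hAv,
    hsymm, ← hu, ← hv] at h₁ h₂ ⊢
  have := dotProduct_comm y u
  have := dotProduct_comm y v
  linarith

theorem Matrix.PosSemidef.trace_mul_nonneg_real {n : Type*} [Fintype n]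
    {A B : Matrix n n ℝ} (hA : A.PosSemidef) (hB : B.PosSemidef) : 0 ≤ (A * B).trace := by
  classical
  obtain ⟨C, rfl⟩ := hB.exists_eq_conjTranspose_mul_self
  rw [← Matrix.mul_assoc, trace_mul_comm, ← Matrix.mul_assoc]
  exact (hA.mul_mul_conjTranspose_same C).trace_nonneg

theorem Matrix.PosDef.log_det_le_trace_sub_card {n : Type*} [Fintype n] [DecidableEq n]
    {A : Matrix n n ℝ} (hA : A.PosDef) : Real.log A.det ≤ A.trace - Fintype.card n := by
  rw [hA.isHermitian.det_eq_prod_eigenvalues, hA.isHermitian.trace_eq_sum_eigenvalues]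
  simp only [RCLike.ofReal_real_eq_id, id]
  rw [Real.log_prod fun i _ => (hA.eigenvalues_pos i).ne']
  calc _ ≤ ∑ i, (hA.isHermitian.eigenvalues i - 1) :=
        Finset.sum_le_sum fun i _ => Real.log_le_sub_one_of_pos (hA.eigenvalues_pos i)
    _ = _ := by simp

/-- The tangent-plane bound for the concave function `log det`. -/
theorem Matrix.PosDef.log_det_le_log_det_add_trace {n : Type*} [Fintype n] [DecidableEq n]
    {A B : Matrix n n ℝ} (hA : A.PosDef) (hB : B.PosDef) :
    Real.log B.det ≤ Real.log A.det + (A⁻¹ * (B - A)).trace := by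
  have hAu := (isUnit_iff_isUnit_det A).1 hA.isUnit
  obtain ⟨C, hC⟩ := hA.inv.posSemidef.exists_eq_conjTranspose_mul_self
  have hdet : (C * B * Cᴴ).det = A.det⁻¹ * B.det := by
    have h := congrArg det hC
    rw [det_nonsing_inv, Ring.inverse_eq_inv', det_mul] at h
    rw [det_mul, det_mul, h]
    ring
  have hpos : (C * B * Cᴴ).PosDef := by
    rw [(hB.posSemidef.mul_mul_conjTranspose_same C).posDef_iff_det_ne_zero, hdet]
    exact mul_ne_zero (inv_ne_zero hA.det_pos.ne') hB.det_pos.ne'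
  have h := hpos.log_det_le_trace_sub_card
  rw [hdet, Real.log_mul (inv_ne_zero hA.det_pos.ne') hB.det_pos.ne', Real.log_inv,
    trace_mul_comm, ← Matrix.mul_assoc, ← hC] at h
  rw [Matrix.mul_sub, nonsing_inv_mul _ hAu, trace_sub, trace_one]
  linarith

theorem stmt_17 {N M : ℕ}
    (Kuu : Matrix (Fin M) (Fin M) ℝ) (hKuu : Kuu.PosDef)
    (Kfu : Matrix (Fin N) (Fin M) ℝ)
    (Kff : Matrix (Fin N) (Fin N) ℝ) (hKff : Kff.IsSymm)
    (hblock : (Matrix.fromBlocks Kff Kfu Kfuᵀ Kuu).PosSemidef)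
    (y : Fin N → ℝ) (σ2 : ℝ) (hσ2 : 0 < σ2) :
    logGaussPDF0 (Kfu * Kuu⁻¹ * Kfuᵀ + σ2 • (1 : Matrix (Fin N) (Fin N) ℝ)) y -
        (1 / (2 * σ2)) * (Kff - Kfu * Kuu⁻¹ * Kfuᵀ).trace ≤
      logGaussPDF0 (Kff + σ2 • (1 : Matrix (Fin N) (Fin N) ℝ)) y := by
  have : Invertible Kuu := hKuu.isUnit.invertible
  have hT : (Kff - Kfu * Kuu⁻¹ * Kfuᵀ).PosSemidef := by
    rw [← conjTranspose_eq_transpose_of_trivial] at hblock ⊢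
    exact (hKuu.fromBlocks₂₂ Kff Kfu).1 hblock
  have hQ : (Kfu * Kuu⁻¹ * Kfuᵀ).PosSemidef := by
    rw [← conjTranspose_eq_transpose_of_trivial]
    exact hKuu.inv.posSemidef.mul_mul_conjTranspose_same Kfu
  set Q := Kfu * Kuu⁻¹ * Kfuᵀ
  have hI : (σ2 • (1 : Matrix (Fin N) (Fin N) ℝ)).PosDef := PosDef.one.smul hσ2
  have hA : (Q + σ2 • (1 : Matrix (Fin N) (Fin N) ℝ)).PosDef := hI.posSemidef_add hQ
  have hdiff : Kff + σ2 • (1 : Matrix (Fin N) (Fin N) ℝ) - (Q + σ2 • 1) = Kff - Q := by abel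
  have hB : (Kff + σ2 • (1 : Matrix (Fin N) (Fin N) ℝ)).PosDef := by
    rw [← sub_add_cancel (Kff + σ2 • (1 : Matrix (Fin N) (Fin N) ℝ)) (Q + σ2 • 1), hdiff]
    exact hA.posSemidef_add hT
  have hquad := (hA.posSemidef_inv_sub_inv_s17 hB (hdiff ▸ hT)).dotProduct_mulVec_nonneg y
  have hlog := hA.log_det_le_log_det_add_trace hB
  have htr := (hI.posSemidef_inv_sub_inv_s17 hA (by simpa using hQ)).trace_mul_nonneg_real hT
  have hinv : (σ2 • (1 : Matrix (Fin N) (Fin N) ℝ))⁻¹ = σ2⁻¹ • 1 :=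
    inv_eq_right_inv (by simp [hσ2.ne'])
  rw [hdiff] at hlog
  rw [hinv, Matrix.sub_mul, trace_sub, smul_mul_assoc, Matrix.one_mul, trace_smul,
    smul_eq_mul] at htr
  rw [star_trivial, sub_mulVec, dotProduct_sub] at hquad
  have hcoef : 1 / (2 * σ2) = 1 / 2 * σ2⁻¹ := by field_simp
  rw [logGaussPDF0, logGaussPDF0, hcoef, mul_assoc]
  linarith
end
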